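/- The generating function Σ_{n≥1} R_3(n)qⁿ equals q⁶(1 + 2q + q² + 2q³ - q⁴ - q⁶ - q⁷ + q⁸) / ((1-q)³(1+q+q²)) as an identity of formal power series; equivalently, (1-q)³(1+q+q²)·Σ_{n≥1} R_3(n)qⁿ = q⁶(1 + 2q + q² + 2q³ - q⁴ - q⁶ - q⁷ + q⁸). -/

import Mathlib

/-- The `i`-th largest part (1-indexed) of a partition, or `0` if out of range. -/
def part {n : ℕ} (p : n.Partition) (i : ℕ) : ℕ :=
  (p.parts.sort (· ≥ ·)).getD (i - 1) 0

open Classical in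
/-- The size of the Durfee triangle of a partition: the largest `k` such that
`λ_i ≥ k + 1 - i` for all `1 ≤ i ≤ k`. -/
noncomputable def durfee {n : ℕ} (p : n.Partition) : ℕ :=
  Nat.findGreatest (fun k => ∀ i ∈ Finset.Icc 1 k, k + 1 ≤ part p i + i) n

open Classical in
/-- `R k n` : the number of partitions of `n` with Durfee triangle size exactly `k`. -/
noncomputable def R (k n : ℕ) : ℕ :=
  (Finset.univ.filter fun p : n.Partition => durfee p = k).card

/-- The partition function. -/
def P (n : ℕ) : ℕ := Fintype.card n.Partition

/-- The maximal Durfee triangle size among partitions of `n`. -/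
noncomputable def F (n : ℕ) : ℕ := Finset.univ.sup fun p : n.Partition => durfee p

open PowerSeries

/-- weight generating function of the elements satisfying a predicate -/
noncomputable def gfP {T : Type} (w : T → ℕ) (A : T → Prop) : PowerSeries ℤ :=
  PowerSeries.mk fun n => (Set.ncard {t | A t ∧ w t = n} : ℤ)

/-- all fibres of the weight are finite -/
def FF {T : Type} (w : T → ℕ) (A : T → Prop) : Prop := ∀ n, Set.Finite {t | A t ∧ w t = n}

lemma gfP_or {T : Type} (w : T → ℕ) (A B C : T → Prop) (hB : FF w B) (hC : FF w C)
    (h : ∀ t, A t ↔ B t ∨ C t) (hd : ∀ t, B t → C t → False) :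
    gfP w A = gfP w B + gfP w C := by
  ext n
  simp only [gfP, map_add, coeff_mk]
  rw [← Nat.cast_add, ← Set.ncard_union_eq _ (hB n) (hC n)]
  · congr 2
    ext t
    simp only [Set.mem_ofPred_eq, Set.mem_union, h]
    tauto
  · rw [Set.disjoint_left]
    rintro t ⟨h1, _⟩ ⟨h2, _⟩
    exact hd t h1 h2

lemma FF_image {S T : Type} (w : T → ℕ) (v : S → ℕ) (B : S → Prop) (A : T → Prop) (f : S → T)
    (hw : ∀ s, w (f s) = v s) (h : ∀ t, A t → ∃ s, B s ∧ f s = t) (hB : FF v B) : FF w A := by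
  intro n
  refine ((hB n).image f).subset ?_
  rintro t ⟨h1, h2⟩
  obtain ⟨s, hs, rfl⟩ := h t h1
  exact ⟨s, ⟨hs, by rw [← hw, h2]⟩, rfl⟩

lemma gfP_image {S T : Type} (w : T → ℕ) (v : S → ℕ) (B : S → Prop) (A : T → Prop) (f : S → T)
    (hw : ∀ s, w (f s) = v s) (h : ∀ t, A t ↔ ∃ s, B s ∧ f s = t)
    (hi : ∀ s t, B s → B t → f s = f t → s = t) : gfP w A = gfP v B := by
  ext n
  simp only [gfP, coeff_mk]
  congr 1
  rw [← Set.ncard_image_of_injOn (f := f) (s := {t | B t ∧ v t = n})]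
  · congr 1
    ext t
    simp only [Set.mem_ofPred_eq, Set.mem_image, h]
    constructor
    · rintro ⟨⟨s, hs, rfl⟩, h2⟩
      exact ⟨s, ⟨hs, by rw [← hw, h2]⟩, rfl⟩
    · rintro ⟨s, ⟨hs, h2⟩, rfl⟩
      exact ⟨⟨s, hs, rfl⟩, by rw [hw, h2]⟩
  · rintro s ⟨hs, _⟩ t ⟨ht, _⟩ hst
    exact hi s t hs ht hst

lemma FF_prod {T : Type} (w : T → ℕ) (a : ℕ) (h : FF w fun _ => True) :
    FF (fun p : ℕ × T => (a + 1) * p.1 + w p.2) fun _ => True := by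
  intro n
  have h1 : Set.Finite (⋃ m ∈ Set.Iic n, {t | True ∧ w t = m}) :=
    (Set.finite_Iic n).biUnion fun m _ => h m
  refine ((Set.finite_Iic n).prod h1).subset ?_
  rintro ⟨x, t⟩ ⟨_, h2⟩
  simp only [Set.mem_prod, Set.mem_Iic, Set.mem_iUnion, Set.mem_ofPred_eq, true_and] at h2 ⊢
  refine ⟨by nlinarith, w t, by nlinarith, rfl⟩

lemma gfP_shift {T : Type} (w : T → ℕ) (d : ℕ) (A : T → Prop) :
    gfP (fun t => d + w t) A = X ^ d * gfP w A := by
  ext n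
  rw [coeff_X_pow_mul']
  simp only [gfP, coeff_mk]
  split_ifs with hd
  · congr 2
    ext t
    simp only [Set.mem_ofPred_eq]
    exact and_congr_right fun _ => by omega
  · norm_cast
    convert Set.ncard_empty T
    ext t
    simp only [Set.mem_ofPred_eq, Set.mem_empty_iff_false, iff_false, not_and]
    intro _; omega

lemma gfP_prod {T : Type} (w : T → ℕ) (a : ℕ) (h : FF w fun _ => True) :
    (1 - X ^ (a + 1)) * gfP (fun p : ℕ × T => (a + 1) * p.1 + w p.2) (fun _ => True)
      = gfP w fun _ => True := by
  have hf := FF_prod w a h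
  have e := gfP_or (fun p : ℕ × T => (a + 1) * p.1 + w p.2) (fun _ => True) (fun p => p.1 = 0)
    (fun p => 1 ≤ p.1) (fun n => (hf n).subset fun t ht => ⟨trivial, ht.2⟩)
    (fun n => (hf n).subset fun t ht => ⟨trivial, ht.2⟩) (by intro t; simp only [true_iff]; omega)
    (by intro t; omega)
  have e1 := gfP_image (fun p : ℕ × T => (a + 1) * p.1 + w p.2) w (fun _ => True)
    (fun p => p.1 = 0) (fun t => (0, t)) (by simp)
    (by rintro ⟨x, t⟩; simp [eq_comm]) (by simp)
  have e2 := gfP_image (fun p : ℕ × T => (a + 1) * p.1 + w p.2)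
    (fun p : ℕ × T => (a + 1) + ((a + 1) * p.1 + w p.2)) (fun _ => True)
    (fun p => 1 ≤ p.1) (fun p => (p.1 + 1, p.2)) (by intro s; simp only; ring)
    (by
      rintro ⟨x, t⟩
      constructor
      · intro hx
        exact ⟨(x - 1, t), trivial, by simp only [Prod.mk.injEq, and_true]; simp only at hx; omega⟩
      · rintro ⟨s, _, hs⟩
        simp only [Prod.mk.injEq] at hs
        simp only; omega)
    (by rintro ⟨x, t⟩ ⟨x', t'⟩; simp)
  rw [gfP_shift] at e2
  rw [e1, e2] at e
  linear_combination e

lemma FF_unit (d : ℕ) : FF (fun _ : Unit => d) fun _ => True := fun _ => Set.toFinite _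

lemma gfP_unit (d : ℕ) : gfP (fun _ : Unit => d) (fun _ => True) = X ^ d := by
  ext n
  simp only [gfP, coeff_mk, coeff_X_pow, true_and]
  by_cases h : d = n
  · simp [h, Set.ncard_univ]
  · simp [h, Ne.symm h]

/-- generic piece -/
noncomputable abbrev W1 (a d : ℕ) : ℕ × Unit → ℕ := fun p => (a + 1) * p.1 + d
noncomputable abbrev W2 (b a d : ℕ) : ℕ × ℕ × Unit → ℕ := fun p => (b + 1) * p.1 + W1 a d p.2
noncomputable abbrev W3 (c b a d : ℕ) : ℕ × ℕ × ℕ × Unit → ℕ :=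
  fun p => (c + 1) * p.1 + W2 b a d p.2

lemma FF1 (a d : ℕ) : FF (W1 a d) fun _ => True := FF_prod (fun _ => d) a (FF_unit d)
lemma FF2 (b a d : ℕ) : FF (W2 b a d) fun _ => True := FF_prod (W1 a d) b (FF1 a d)
lemma FF3 (c b a d : ℕ) : FF (W3 c b a d) fun _ => True := FF_prod (W2 b a d) c (FF2 b a d)

lemma gf1 (a d : ℕ) : (1 - X ^ (a + 1)) * gfP (W1 a d) (fun _ => True) = X ^ d := by
  rw [← gfP_unit d]; exact gfP_prod (fun _ => d) a (FF_unit d)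
lemma gf2 (b a d : ℕ) : (1 - X ^ (a + 1)) * ((1 - X ^ (b + 1)) * gfP (W2 b a d) (fun _ => True))
    = X ^ d := by
  rw [← gf1 a d]; congr 1; exact gfP_prod (W1 a d) b (FF1 a d)
lemma gf3 (c b a d : ℕ) : (1 - X ^ (a + 1)) * ((1 - X ^ (b + 1)) *
    ((1 - X ^ (c + 1)) * gfP (W3 c b a d) (fun _ => True))) = X ^ d := by
  rw [← gf2 b a d]; congr 2; exact gfP_prod (W2 b a d) c (FF2 b a d)

section pieces
variable (w : ℕ × ℕ × ℕ → ℕ) (A : ℕ × ℕ × ℕ → Prop)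

lemma piece1 (a d : ℕ) (f : ℕ → ℕ × ℕ × ℕ) (hw : ∀ x, w (f x) = (a + 1) * x + d)
    (h : ∀ t, A t ↔ ∃ x, f x = t) (hi : ∀ x x', f x = f x' → x = x') :
    FF w A ∧ (1 - X ^ (a + 1)) * gfP w A = X ^ d := by
  have h' : ∀ t, A t ↔ ∃ s : ℕ × Unit, True ∧ f s.1 = t := by
    intro t; rw [h]; simp
  refine ⟨FF_image w (W1 a d) (fun _ => True) A (fun s => f s.1) (fun s => hw s.1)
    (fun t => (h' t).1) (FF1 a d), ?_⟩
  rw [gfP_image w (W1 a d) (fun _ => True) A (fun s => f s.1) (fun s => hw s.1) h', gf1]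
  rintro ⟨x, _⟩ ⟨x', _⟩ _ _ hx
  obtain rfl := hi _ _ hx
  rfl

lemma piece2 (b a d : ℕ) (f : ℕ → ℕ → ℕ × ℕ × ℕ)
    (hw : ∀ x y, w (f x y) = (b + 1) * x + ((a + 1) * y + d))
    (h : ∀ t, A t ↔ ∃ x y, f x y = t) (hi : ∀ x y x' y', f x y = f x' y' → x = x' ∧ y = y') :
    FF w A ∧ (1 - X ^ (a + 1)) * ((1 - X ^ (b + 1)) * gfP w A) = X ^ d := by
  have h' : ∀ t, A t ↔ ∃ s : ℕ × ℕ × Unit, True ∧ f s.1 s.2.1 = t := by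
    intro t; rw [h]; simp
  refine ⟨FF_image w (W2 b a d) (fun _ => True) A (fun s => f s.1 s.2.1) (fun s => hw s.1 s.2.1)
    (fun t => (h' t).1) (FF2 b a d), ?_⟩
  rw [gfP_image w (W2 b a d) (fun _ => True) A (fun s => f s.1 s.2.1)
    (fun s => hw s.1 s.2.1) h', gf2]
  rintro ⟨x, y, _⟩ ⟨x', y', _⟩ _ _ hx
  obtain ⟨rfl, rfl⟩ := hi _ _ _ _ hx
  rfl

lemma piece3 (c b a d : ℕ) (f : ℕ → ℕ → ℕ → ℕ × ℕ × ℕ)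
    (hw : ∀ x y z, w (f x y z) = (c + 1) * x + ((b + 1) * y + ((a + 1) * z + d)))
    (h : ∀ t, A t ↔ ∃ x y z, f x y z = t)
    (hi : ∀ x y z x' y' z', f x y z = f x' y' z' → x = x' ∧ y = y' ∧ z = z') :
    FF w A ∧ (1 - X ^ (a + 1)) * ((1 - X ^ (b + 1)) * ((1 - X ^ (c + 1)) * gfP w A)) = X ^ d := by
  have h' : ∀ t, A t ↔ ∃ s : ℕ × ℕ × ℕ × Unit, True ∧ f s.1 s.2.1 s.2.2.1 = t := by
    intro t; rw [h]; simp
  refine ⟨FF_image w (W3 c b a d) (fun _ => True) A (fun s => f s.1 s.2.1 s.2.2.1)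
    (fun s => hw s.1 s.2.1 s.2.2.1) (fun t => (h' t).1) (FF3 c b a d), ?_⟩
  rw [gfP_image w (W3 c b a d) (fun _ => True) A (fun s => f s.1 s.2.1 s.2.2.1)
    (fun s => hw s.1 s.2.1 s.2.2.1) h', gf3]
  rintro ⟨x, y, z, _⟩ ⟨x', y', z', _⟩ _ _ hx
  obtain ⟨rfl, rfl, rfl⟩ := hi _ _ _ _ _ _ hx
  rfl

end pieces

lemma FF_or {T : Type} (w : T → ℕ) (A B C : T → Prop) (hB : FF w B) (hC : FF w C)
    (h : ∀ t, A t ↔ B t ∨ C t) : FF w A := by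
  intro n
  refine ((hB n).union (hC n)).subset ?_
  rintro t ⟨h1, h2⟩
  rcases (h t).1 h1 with h3 | h3
  · exact Or.inl ⟨h3, h2⟩
  · exact Or.inr ⟨h3, h2⟩

lemma or_both {T : Type} (w : T → ℕ) (A B C : T → Prop) (hB : FF w B) (hC : FF w C)
    (h : ∀ t, A t ↔ B t ∨ C t) (hd : ∀ t, B t → C t → False) :
    FF w A ∧ gfP w A = gfP w B + gfP w C := ⟨FF_or w A B C hB hC h, gfP_or w A B C hB hC h hd⟩

def wA : ℕ × ℕ × ℕ → ℕ := fun t => t.1 + t.2.1 + t.2.2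
def wC : ℕ × ℕ × ℕ → ℕ := fun t => t.1 + 2 * t.2.1 + t.2.2
def wD : ℕ × ℕ × ℕ → ℕ := fun t => 3 * t.1 + 2 * t.2.1 + t.2.2
def tA : ℕ × ℕ × ℕ → Prop := fun t => 1 ≤ t.2.2 ∧ t.2.2 ≤ t.2.1 ∧ t.2.1 ≤ t.1 ∧ 2 ≤ t.2.1 ∧ 3 ≤ t.1
def tB : ℕ × ℕ × ℕ → Prop := fun t => 2 ≤ t.2.2 ∧ 2 ≤ t.2.1 ∧ t.2.1 ≤ t.1 ∧ 3 ≤ t.1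
def tC : ℕ × ℕ × ℕ → Prop := fun t => 3 ≤ t.1 ∧ 2 ≤ t.2.1 ∧ 3 ≤ t.2.1 + t.2.2
def tD : ℕ × ℕ × ℕ → Prop := fun t => 2 ≤ t.1 ∧ 3 ≤ t.1 + t.2.1 ∧ 4 ≤ t.1 + t.2.1 + t.2.2

lemma mainB : FF wA tB ∧ (1 - X) ^ 2 * (1 - X ^ 2) * gfP wA tB
    = X ^ 7 * (1 - X ^ 2) + X ^ 8 := by
  obtain ⟨f1, g1⟩ := piece2 wA (fun t => 3 ≤ t.1 ∧ t.2.1 = 2 ∧ 2 ≤ t.2.2) 0 0 7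
    (fun x y => (3 + x, 2, 2 + y)) (by intro x y; simp only [wA]; ring)
    (by
      rintro ⟨a, b, c⟩
      simp only [Prod.mk.injEq]
      exact ⟨fun h => ⟨a - 3, c - 2, by omega⟩, fun ⟨x, y, h⟩ => by omega⟩)
    (by intro x y x' y'; simp only [Prod.mk.injEq]; omega)
  obtain ⟨f2, g2⟩ := piece3 wA (fun t => t.2.1 ≤ t.1 ∧ 3 ≤ t.2.1 ∧ 2 ≤ t.2.2) 1 0 0 8
    (fun x y z => (3 + x + y, 3 + x, 2 + z)) (by intro x y z; simp only [wA]; ring)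
    (by
      rintro ⟨a, b, c⟩
      simp only [Prod.mk.injEq]
      exact ⟨fun h => ⟨b - 3, a - b, c - 2, by omega⟩, fun ⟨x, y, z, h⟩ => by omega⟩)
    (by intro x y z x' y' z'; simp only [Prod.mk.injEq]; omega)
  obtain ⟨f, g⟩ := or_both wA tB _ _ f1 f2 (by intro t; simp only [tB]; omega)
    (by intro t; omega)
  refine ⟨f, ?_⟩
  rw [g]
  norm_num at g1 g2
  linear_combination (1 - X ^ 2) * g1 + g2

lemma mainC : FF wC tC ∧ (1 - X) ^ 2 * (1 - X ^ 2) * gfP wC tC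
    = X ^ 8 * (1 - X ^ 2) + X ^ 9 := by
  obtain ⟨f1, g1⟩ := piece2 wC (fun t => 3 ≤ t.1 ∧ t.2.1 = 2 ∧ 1 ≤ t.2.2) 0 0 8
    (fun x y => (3 + x, 2, 1 + y)) (by intro x y; simp only [wC]; ring)
    (by
      rintro ⟨a, b, c⟩
      simp only [Prod.mk.injEq]
      exact ⟨fun h => ⟨a - 3, c - 1, by omega⟩, fun ⟨x, y, h⟩ => by omega⟩)
    (by intro x y x' y'; simp only [Prod.mk.injEq]; omega)
  obtain ⟨f2, g2⟩ := piece3 wC (fun t => 3 ≤ t.1 ∧ 3 ≤ t.2.1) 1 0 0 9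
    (fun x y z => (3 + y, 3 + x, z)) (by intro x y z; simp only [wC]; ring)
    (by
      rintro ⟨a, b, c⟩
      simp only [Prod.mk.injEq]
      exact ⟨fun h => ⟨b - 3, a - 3, c, by omega⟩, fun ⟨x, y, z, h⟩ => by omega⟩)
    (by intro x y z x' y' z'; simp only [Prod.mk.injEq]; omega)
  obtain ⟨f, g⟩ := or_both wC tC _ _ f1 f2 (by intro t; simp only [tC]; omega)
    (by intro t; omega)
  refine ⟨f, ?_⟩
  rw [g]
  norm_num at g1 g2
  linear_combination (1 - X ^ 2) * g1 + g2

lemma mainA : FF wA tA ∧ (1 - X) * (1 - X ^ 2) * (1 - X ^ 3) * gfP wA tA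
    = (X ^ 6 + X ^ 7) * (1 - X ^ 2) * (1 - X ^ 3) + (X ^ 7 + X ^ 8) * (1 - X ^ 3) + X ^ 9 := by
  have P1 : ∀ c, 1 ≤ c ∧ c ≤ 2 → _ := fun c hc =>
    piece1 wA (fun t => 3 ≤ t.1 ∧ t.2.1 = 2 ∧ t.2.2 = c) 0 (5 + c)
    (fun x => (3 + x, 2, c)) (by intro x; simp only [wA]; ring)
    (by
      rintro ⟨a, b, c⟩
      simp only [Prod.mk.injEq]
      exact ⟨fun h => ⟨a - 3, by omega⟩, fun ⟨x, h⟩ => by omega⟩)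
    (by intro x x'; simp only [Prod.mk.injEq]; omega)
  have P2 : ∀ c, 1 ≤ c ∧ c ≤ 2 → _ := fun c hc =>
    piece2 wA (fun t => t.2.1 ≤ t.1 ∧ 3 ≤ t.2.1 ∧ t.2.2 = c) 1 0 (6 + c)
    (fun x y => (3 + x + y, 3 + x, c)) (by intro x y; simp only [wA]; ring)
    (by
      rintro ⟨a, b, c⟩
      simp only [Prod.mk.injEq]
      exact ⟨fun h => ⟨b - 3, a - b, by omega⟩, fun ⟨x, y, h⟩ => by omega⟩)
    (by intro x y x' y'; simp only [Prod.mk.injEq]; omega)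
  obtain ⟨f1, g1⟩ := P1 1 (by omega)
  obtain ⟨f2, g2⟩ := P1 2 (by omega)
  obtain ⟨f3, g3⟩ := P2 1 (by omega)
  obtain ⟨f4, g4⟩ := P2 2 (by omega)
  obtain ⟨f5, g5⟩ := piece3 wA (fun t => t.2.1 ≤ t.1 ∧ t.2.2 ≤ t.2.1 ∧ 3 ≤ t.2.2) 2 1 0 9
    (fun x y z => (3 + x + y + z, 3 + x + y, 3 + x)) (by intro x y z; simp only [wA]; ring)
    (by
      rintro ⟨a, b, c⟩
      simp only [Prod.mk.injEq]
      exact ⟨fun h => ⟨c - 3, b - c, a - b, by omega⟩, fun ⟨x, y, z, h⟩ => by omega⟩)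
    (by intro x y z x' y' z'; simp only [Prod.mk.injEq]; omega)
  obtain ⟨f12, g12⟩ := or_both wA _ _ _ f1 f2 (fun t => Iff.rfl) (by intro t; omega)
  obtain ⟨f34, g34⟩ := or_both wA _ _ _ f3 f4 (fun t => Iff.rfl) (by intro t; omega)
  obtain ⟨f14, g14⟩ := or_both wA _ _ _ f12 f34 (fun t => Iff.rfl) (by intro t; omega)
  obtain ⟨f, g⟩ := or_both wA tA _ _ f14 f5 (by intro t; simp only [tA]; omega)
    (by intro t; omega)
  refine ⟨f, ?_⟩
  rw [g, g14, g12, g34]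
  norm_num at g1 g2 g3 g4 g5
  linear_combination (1 - X ^ 2) * (1 - X ^ 3) * (g1 + g2) + (1 - X ^ 3) * (g3 + g4) + g5

lemma mainD : FF wD tD ∧ (1 - X) * (1 - X ^ 2) * (1 - X ^ 3) * gfP wD tD
    = X ^ 10 * (1 - X ^ 2) + X ^ 11 + X ^ 9 * (1 - X ^ 2) * (1 - X ^ 3)
      + X ^ 10 * (1 - X ^ 3) + X ^ 12 * (1 - X) * (1 - X ^ 2) := by
  obtain ⟨f1, g1⟩ := piece2 wD (fun t => 3 ≤ t.1 ∧ t.2.1 = 0 ∧ 1 ≤ t.2.2) 2 0 10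
    (fun x y => (3 + x, 0, 1 + y)) (by intro x y; simp only [wD]; ring)
    (by
      rintro ⟨a, b, c⟩
      simp only [Prod.mk.injEq]
      exact ⟨fun h => ⟨a - 3, c - 1, by omega⟩, fun ⟨x, y, h⟩ => by omega⟩)
    (by intro x y x' y'; simp only [Prod.mk.injEq]; omega)
  obtain ⟨f2, g2⟩ := piece3 wD (fun t => 3 ≤ t.1 ∧ 1 ≤ t.2.1) 2 1 0 11
    (fun x y z => (3 + x, 1 + y, z)) (by intro x y z; simp only [wD]; ring)
    (by
      rintro ⟨a, b, c⟩
      simp only [Prod.mk.injEq]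
      exact ⟨fun h => ⟨a - 3, b - 1, c, by omega⟩, fun ⟨x, y, z, h⟩ => by omega⟩)
    (by intro x y z x' y' z'; simp only [Prod.mk.injEq]; omega)
  obtain ⟨f3, g3⟩ := piece1 wD (fun t => t.1 = 2 ∧ t.2.1 = 1 ∧ 1 ≤ t.2.2) 0 9
    (fun x => (2, 1, 1 + x)) (by intro x; simp only [wD]; ring)
    (by
      rintro ⟨a, b, c⟩
      simp only [Prod.mk.injEq]
      exact ⟨fun h => ⟨c - 1, by omega⟩, fun ⟨x, h⟩ => by omega⟩)
    (by intro x x'; simp only [Prod.mk.injEq]; omega)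
  obtain ⟨f4, g4⟩ := piece2 wD (fun t => t.1 = 2 ∧ 2 ≤ t.2.1) 1 0 10
    (fun x y => (2, 2 + x, y)) (by intro x y; simp only [wD]; ring)
    (by
      rintro ⟨a, b, c⟩
      simp only [Prod.mk.injEq]
      exact ⟨fun h => ⟨b - 2, c, by omega⟩, fun ⟨x, y, h⟩ => by omega⟩)
    (by intro x y x' y'; simp only [Prod.mk.injEq]; omega)
  obtain ⟨f5, g5⟩ := piece1 wD (fun t => 4 ≤ t.1 ∧ t.2.1 = 0 ∧ t.2.2 = 0) 2 12
    (fun x => (4 + x, 0, 0)) (by intro x; simp only [wD]; ring)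
    (by
      rintro ⟨a, b, c⟩
      simp only [Prod.mk.injEq]
      exact ⟨fun h => ⟨a - 4, by omega⟩, fun ⟨x, h⟩ => by omega⟩)
    (by intro x x'; simp only [Prod.mk.injEq]; omega)
  obtain ⟨f12, g12⟩ := or_both wD _ _ _ f1 f2 (fun t => Iff.rfl) (by intro t; omega)
  obtain ⟨f34, g34⟩ := or_both wD _ _ _ f3 f4 (fun t => Iff.rfl) (by intro t; omega)
  obtain ⟨f14, g14⟩ := or_both wD _ _ _ f12 f34 (fun t => Iff.rfl) (by intro t; omega)
  obtain ⟨f, g⟩ := or_both wD tD _ _ f14 f5 (by intro t; simp only [tD]; omega)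
    (by intro t; omega)
  refine ⟨f, ?_⟩
  rw [g, g14, g12, g34]
  norm_num at g1 g2 g3 g4 g5
  linear_combination (1 - X ^ 2) * g1 + g2 + (1 - X ^ 2) * (1 - X ^ 3) * g3 + (1 - X ^ 3) * g4
    + (1 - X) * (1 - X ^ 2) * g5

/-- sorted positive lists with Durfee triangle size 3 -/
def LQ (l : List ℕ) : Prop :=
  l.Pairwise (· ≥ ·) ∧ (∀ x ∈ l, 1 ≤ x) ∧ 3 ≤ l.getD 0 0 ∧ 2 ≤ l.getD 1 0 ∧ 1 ≤ l.getD 2 0 ∧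
    ¬ (4 ≤ l.getD 0 0 ∧ 3 ≤ l.getD 1 0 ∧ 2 ≤ l.getD 2 0 ∧ 1 ≤ l.getD 3 0)

lemma ones (l : List ℕ) (h : ∀ x ∈ l, 1 ≤ x ∧ x ≤ 1) : ∃ c, l = List.replicate c 1 :=
  ⟨l.length, List.eq_replicate_iff.2 ⟨rfl, fun x hx => by have := h x hx; omega⟩⟩

lemma twos (l : List ℕ) (hs : l.Pairwise (· ≥ ·)) (h : ∀ x ∈ l, 1 ≤ x ∧ x ≤ 2) :
    ∃ b c, l = List.replicate b 2 ++ List.replicate c 1 := by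
  induction l with
  | nil => exact ⟨0, 0, rfl⟩
  | cons x l ih =>
    rw [List.pairwise_cons] at hs
    have hx := h x (by simp)
    have hl : ∀ y ∈ l, 1 ≤ y ∧ y ≤ 2 := fun y hy => h y (by simp [hy])
    rcases Nat.lt_or_ge x 2 with h1 | h1
    · obtain ⟨c, hc⟩ := ones (x :: l) (by
        intro y hy
        rcases List.mem_cons.1 hy with rfl | hy
        · omega
        · have := hs.1 y hy; have := hl y hy; omega)
      exact ⟨0, c, by simpa using hc⟩
    · obtain ⟨b, c, hc⟩ := ih hs.2 hl
      obtain rfl : x = 2 := by omega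
      exact ⟨b + 1, c, by simp [hc, List.replicate_succ]⟩

lemma threes (l : List ℕ) (hs : l.Pairwise (· ≥ ·)) (h : ∀ x ∈ l, 1 ≤ x ∧ x ≤ 3) :
    ∃ a b c, l = List.replicate a 3 ++ (List.replicate b 2 ++ List.replicate c 1) := by
  induction l with
  | nil => exact ⟨0, 0, 0, rfl⟩
  | cons x l ih =>
    rw [List.pairwise_cons] at hs
    have hx := h x (by simp)
    have hl : ∀ y ∈ l, 1 ≤ y ∧ y ≤ 3 := fun y hy => h y (by simp [hy])
    rcases Nat.lt_or_ge x 3 with h1 | h1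
    · obtain ⟨b, c, hc⟩ := twos (x :: l) (List.pairwise_cons.2 hs) (by
        intro y hy
        rcases List.mem_cons.1 hy with rfl | hy
        · omega
        · have := hs.1 y hy; have := hl y hy; omega)
      exact ⟨0, b, c, by simpa using hc⟩
    · obtain ⟨a, b, c, hc⟩ := ih hs.2 hl
      obtain rfl : x = 3 := by omega
      exact ⟨a + 1, b, c, by simp [hc, List.replicate_succ]⟩

def fA : ℕ × ℕ × ℕ → List ℕ := fun t => [t.1, t.2.1, t.2.2]
def fB : ℕ × ℕ × ℕ → List ℕ := fun t => t.1 :: t.2.1 :: List.replicate t.2.2 1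
def fC : ℕ × ℕ × ℕ → List ℕ :=
  fun t => t.1 :: (List.replicate t.2.1 2 ++ List.replicate t.2.2 1)
def fD : ℕ × ℕ × ℕ → List ℕ :=
  fun t => List.replicate t.1 3 ++ (List.replicate t.2.1 2 ++ List.replicate t.2.2 1)

def LA (l : List ℕ) : Prop := LQ l ∧ l.getD 3 0 = 0
def LB (l : List ℕ) : Prop := LQ l ∧ 1 ≤ l.getD 3 0 ∧ l.getD 2 0 = 1
def LC (l : List ℕ) : Prop := LQ l ∧ 1 ≤ l.getD 3 0 ∧ 2 ≤ l.getD 2 0 ∧ l.getD 1 0 = 2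
def LD (l : List ℕ) : Prop := LQ l ∧ 1 ≤ l.getD 3 0 ∧ 2 ≤ l.getD 2 0 ∧ 3 ≤ l.getD 1 0

lemma exA (l : List ℕ) : LA l ↔ ∃ t, tA t ∧ fA t = l := by
  constructor
  · rintro ⟨⟨hs, hp, h0, h1, h2, hn⟩, h3⟩
    match l with
    | [] => simp at h0
    | [_] => simp at h1
    | [_, _] => simp at h2
    | [a, b, c] =>
      refine ⟨(a, b, c), ?_, rfl⟩
      simp at hs h0 h1 h2
      simp only [tA]; omega
    | a :: b :: c :: d :: l =>
      have := hp d (by simp)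
      simp at h3; omega
  · rintro ⟨⟨a, b, c⟩, ht, rfl⟩
    simp only [tA] at ht
    refine ⟨⟨?_, ?_, ?_⟩, ?_⟩ <;> simp [fA] <;> omega

lemma exB (l : List ℕ) : LB l ↔ ∃ t, tB t ∧ fB t = l := by
  constructor
  · rintro ⟨⟨hs, hp, h0, h1, h2, hn⟩, h3, h4⟩
    match l with
    | [] => simp at h0
    | [_] => simp at h1
    | [_, _] => simp at h2
    | [a, b, c] => simp at h3
    | a :: b :: c :: d :: l =>
      simp only [List.pairwise_cons] at hs
      simp at h0 h1 h4
      obtain ⟨m, hm⟩ := ones (c :: d :: l) (by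
        intro x hx
        refine ⟨hp x (by simp at hx ⊢; tauto), ?_⟩
        rcases List.mem_cons.1 hx with rfl | hx
        · omega
        · have := hs.2.2.1 x hx; omega)
      refine ⟨(a, b, m), ?_, by simp [fB, hm]⟩
      have hl := congrArg List.length hm
      simp at hl
      have := hs.1 b (by simp)
      simp only [tB]; omega
  · rintro ⟨⟨a, b, c⟩, ht, rfl⟩
    simp only [tB] at ht
    obtain ⟨c, rfl⟩ : ∃ d, c = d + 2 := ⟨c - 2, by omega⟩
    refine ⟨⟨?_, ?_, ?_⟩, ?_⟩ <;>
      simp [fB, List.replicate_succ, List.pairwise_replicate] <;> omega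

lemma exC (l : List ℕ) : LC l ↔ ∃ t, tC t ∧ fC t = l := by
  constructor
  · rintro ⟨⟨hs, hp, h0, h1, h2, hn⟩, h3, h4, h5⟩
    match l with
    | [] => simp at h0
    | [_] => simp at h1
    | [_, _] => simp at h2
    | [a, b, c] => simp at h3
    | a :: b :: c :: d :: l =>
      rw [List.pairwise_cons] at hs
      simp at h0 h5 h4
      have hs2 := List.pairwise_cons.1 hs.2
      have := hs2.1 c (by simp)
      obtain ⟨m, k, hm⟩ := twos (b :: c :: d :: l) hs.2 (by
        intro x hx
        refine ⟨hp x (by simp at hx ⊢; tauto), ?_⟩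
        rcases List.mem_cons.1 hx with rfl | hx
        · omega
        · have := hs2.1 x hx; omega)
      refine ⟨(a, m, k), ?_, by simp [fC, hm]⟩
      have hl := congrArg List.length hm
      simp at hl
      have : 2 ≤ m := by
        match m with
        | 0 => cases k <;> simp [List.replicate_succ] at hm; omega
        | 1 =>
          simp at hm
          rcases k with _ | k
          · simp at hm
          · simp [List.replicate_succ] at hm; omega
        | m + 2 => omega
      simp only [tC]; omega
  · rintro ⟨⟨a, b, c⟩, ht, rfl⟩
    simp only [tC] at ht
    obtain ⟨b, rfl⟩ : ∃ d, b = d + 2 := ⟨b - 2, by omega⟩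
    refine ⟨⟨?_, ?_, ?_⟩, ?_⟩
    · simp [fC, List.pairwise_append, List.pairwise_replicate]
      omega
    · simp [fC]; omega
    · simp [fC, List.replicate_succ]; omega
    · rcases b with _ | b
      · obtain ⟨c, rfl⟩ : ∃ d, c = d + 1 := ⟨c - 1, by omega⟩
        simp [fC, List.replicate_succ]
      · simp [fC, List.replicate_succ]

lemma exD (l : List ℕ) : LD l ↔ ∃ t, tD t ∧ fD t = l := by
  constructor
  · rintro ⟨⟨hs, hp, h0, h1, h2, hn⟩, h3, h4, h5⟩
    match l with
    | [] => simp at h0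
    | [_] => simp at h1
    | [_, _] => simp at h2
    | [a, b, c] => simp at h3
    | a :: b :: c :: d :: l =>
      have hs2 := List.pairwise_cons.1 hs
      simp at h0 h5 h4 h3 hn
      obtain ⟨m, k, j, hm⟩ := threes (a :: b :: c :: d :: l) hs (by
        intro x hx
        refine ⟨hp x hx, ?_⟩
        rcases List.mem_cons.1 hx with rfl | hx
        · omega
        · have := hs2.1 x hx; omega)
      refine ⟨(m, k, j), ?_, by simp [fD, hm]⟩
      have hl := congrArg List.length hm
      simp at hl
      have e0 := congrArg (fun l => l.getD 0 0) hm
      have e1 := congrArg (fun l => l.getD 1 0) hm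
      have e2 := congrArg (fun l => l.getD 2 0) hm
      simp [List.getElem?_append, List.getElem?_replicate] at e0 e1 e2
      simp only [tD]
      clear hs hp hs2 hm h1 h2
      split_ifs at e0 e1 e2 <;>
        simp only [Option.getD_some, Option.getD_none] at e0 e1 e2 <;> omega
  · rintro ⟨⟨a, b, c⟩, ht, rfl⟩
    simp only [tD] at ht
    refine ⟨⟨?_, ?_, ?_⟩, ?_⟩
    · simp [fD, List.pairwise_append, List.pairwise_replicate]
      grind
    · simp [fD]; grind
    · simp [fD, List.getElem?_append, List.getElem?_replicate]; grind
    · simp [fD, List.getElem?_append, List.getElem?_replicate]; grind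

lemma injA (s t) : tA s → tA t → fA s = fA t → s = t := by
  rintro - - h
  simpa [fA, Prod.ext_iff] using h
lemma injB (s t) : tB s → tB t → fB s = fB t → s = t := by
  rintro - - h
  have := congrArg List.length h
  simp [fB] at h this
  simp [Prod.ext_iff]; omega
lemma inj2 {a b c d : ℕ} (h : List.replicate a 2 ++ List.replicate b 1 =
    List.replicate c 2 ++ List.replicate d 1) : a = c ∧ b = d := by
  have h1 := congrArg (List.count 2) h
  have h2 := congrArg (List.count 1) h
  simp [List.count_replicate] at h1 h2
  omega
lemma injC (s t) : tC s → tC t → fC s = fC t → s = t := by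
  rintro - - h
  simp only [fC, List.cons.injEq] at h
  have := inj2 h.2
  simp [Prod.ext_iff]; omega
lemma injD (s t) : tD s → tD t → fD s = fD t → s = t := by
  rintro - - h
  have h1 := congrArg (List.count 2) h
  have h2 := congrArg (List.count 1) h
  have h3 := congrArg (List.count 3) h
  simp [fD, List.count_replicate] at h1 h2 h3
  simp [Prod.ext_iff]; omega

lemma LQ_gf : (1 - X) ^ 3 * (1 + X + X ^ 2) * gfP List.sum LQ =
      X ^ 6 * (1 + 2 * X + X ^ 2 + 2 * X ^ 3 - X ^ 4 - X ^ 6 - X ^ 7 + X ^ 8 :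
        PowerSeries ℤ) := by
  obtain ⟨FA, GA⟩ := mainA
  obtain ⟨FB, GB⟩ := mainB
  obtain ⟨FC, GC⟩ := mainC
  obtain ⟨FD, GD⟩ := mainD
  have swA : ∀ s, (fA s).sum = wA s := by intro s; simp [fA, wA]; ring
  have swB : ∀ s, (fB s).sum = wA s := by intro s; simp [fB, wA]; ring
  have swC : ∀ s, (fC s).sum = wC s := by intro s; simp [fC, wC]; ring
  have swD : ∀ s, (fD s).sum = wD s := by intro s; simp [fD, wD]; ring
  have FA' := FF_image List.sum wA tA LA fA swA (fun t => (exA t).1) FA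
  have FB' := FF_image List.sum wA tB LB fB swB (fun t => (exB t).1) FB
  have FC' := FF_image List.sum wC tC LC fC swC (fun t => (exC t).1) FC
  have FD' := FF_image List.sum wD tD LD fD swD (fun t => (exD t).1) FD
  rw [← gfP_image List.sum wA tA LA fA swA exA injA] at GA
  rw [← gfP_image List.sum wA tB LB fB swB exB injB] at GB
  rw [← gfP_image List.sum wC tC LC fC swC exC injC] at GC
  rw [← gfP_image List.sum wD tD LD fD swD exD injD] at GD
  obtain ⟨fAB, gAB⟩ := or_both List.sum _ _ _ FA' FB' (fun t => Iff.rfl)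
    (by intro t; simp only [LA, LB]; omega)
  obtain ⟨fCD, gCD⟩ := or_both List.sum _ _ _ FC' FD' (fun t => Iff.rfl)
    (by intro t; simp only [LC, LD]; omega)
  obtain ⟨f, g⟩ := or_both List.sum LQ _ _ fAB fCD
    (by
      intro t; simp only [LA, LB, LC, LD]
      constructor
      · intro h
        have h' := h.2.2
        simp only [h, true_and]
        omega
      · tauto)
    (by intro t; simp only [LA, LB, LC, LD]; omega)
  have hne : (1 - X ^ 2 : PowerSeries ℤ) ≠ 0 := by
    intro h
    have := congrArg constantCoeff h
    simp at this
  apply mul_left_cancel₀ hne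
  rw [g, gAB, gCD]
  linear_combination (1 - X) * (GA + GD) + (1 - X ^ 3) * (GB + GC)

lemma fg_iff (Q : ℕ → Prop) (inst : DecidablePred Q) (k m : ℕ) :
    @Nat.findGreatest Q inst k = m ↔ m ≤ k ∧ (m ≠ 0 → Q m) ∧ ∀ ⦃n⦄, m < n → n ≤ k → ¬ Q n :=
  Nat.findGreatest_eq_iff

lemma durfee_iff {n : ℕ} (p : n.Partition) : durfee p = 3 ↔ LQ (p.parts.sort (· ≥ ·)) := by
  have hs : (p.parts.sort (· ≥ ·)).Pairwise (· ≥ ·) := Multiset.pairwise_sort _ _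
  have hp : ∀ x ∈ p.parts.sort (· ≥ ·), 1 ≤ x := fun x hx => p.parts_pos (by simpa using hx)
  have hle : part p 1 ≤ n := by
    have h1 : (p.parts.sort (· ≥ ·)).sum = n := by
      rw [← Multiset.sum_coe, Multiset.sort_eq, p.parts_sum]
    unfold part
    refine le_trans ?_ h1.le
    cases p.parts.sort (· ≥ ·) <;> simp
  have e : LQ (p.parts.sort (· ≥ ·)) ↔ 3 ≤ part p 1 ∧ 2 ≤ part p 2 ∧ 1 ≤ part p 3 ∧
      ¬ (4 ≤ part p 1 ∧ 3 ≤ part p 2 ∧ 2 ≤ part p 3 ∧ 1 ≤ part p 4) := by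
    unfold LQ part
    simp only [hs, true_and]
    exact ⟨fun h => h.2, fun h => ⟨hp, h⟩⟩
  rw [e, durfee]
  refine (fg_iff _ _ _ _).trans ?_
  constructor
  · rintro ⟨h3, h, h4⟩
    have h := h (by norm_num)
    have a1 := h 1 (by simp)
    have a2 := h 2 (by simp)
    have a3 := h 3 (by simp)
    refine ⟨by omega, by omega, by omega, ?_⟩
    rintro ⟨b1, b2, b3, b4⟩
    refine h4 (n := 4) (by norm_num) (by omega) ?_
    intro i hi
    rw [Finset.mem_Icc] at hi
    obtain ⟨hi1, hi2⟩ := hi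
    interval_cases i <;> omega
  · rintro ⟨a1, a2, a3, h⟩
    refine ⟨by omega, ?_, ?_⟩
    · intro _ i hi
      rw [Finset.mem_Icc] at hi
      obtain ⟨hi1, hi2⟩ := hi
      interval_cases i <;> omega
    · intro k hk _ hh
      have b1 := hh 1 (by simp; omega)
      have b2 := hh 2 (by simp; omega)
      have b3 := hh 3 (by simp; omega)
      have b4 := hh 4 (by simp; omega)
      omega

lemma R_eq (n : ℕ) : R 3 n = Set.ncard {l | LQ l ∧ l.sum = n} := by
  classical
  unfold R
  rw [← Set.ncard_coe_finset,
    ← Set.ncard_image_of_injective (f := fun p : n.Partition => p.parts.sort (· ≥ ·))]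
  · congr 1
    ext l
    simp only [Finset.coe_filter, Finset.mem_univ, true_and, Set.mem_image, Set.mem_ofPred_eq]
    constructor
    · rintro ⟨p, hp, rfl⟩
      refine ⟨(durfee_iff p).1 hp, ?_⟩
      rw [← Multiset.sum_coe, Multiset.sort_eq, p.parts_sum]
    · rintro ⟨h, hs⟩
      have e : (l : Multiset ℕ).sort (· ≥ ·) = l := by
        refine List.Perm.eq_of_pairwise' (Multiset.pairwise_sort _ _) h.1 ?_
        rw [← Multiset.coe_eq_coe, Multiset.sort_eq]
      let p : n.Partition := ⟨l, fun {i} hi => h.2.1 i (by simpa using hi), by simpa using hs⟩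
      exact ⟨p, (durfee_iff p).2 (by rw [show p.parts = (l : Multiset ℕ) from rfl, e]; exact h), e⟩
  · intro p q h
    have := congrArg (fun l : List ℕ => (l : Multiset ℕ)) h
    simp only [Multiset.sort_eq] at this
    exact Nat.Partition.ext this

open PowerSeries in
theorem R_three_generating_function :
    (1 - X) ^ 3 * (1 + X + X ^ 2) *
        PowerSeries.mk (fun n => if n = 0 then 0 else (R 3 n : ℤ)) =
      X ^ 6 * (1 + 2 * X + X ^ 2 + 2 * X ^ 3 - X ^ 4 - X ^ 6 - X ^ 7 + X ^ 8 :
        PowerSeries ℤ) := by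
  rw [← LQ_gf]
  congr 1
  ext n
  simp only [gfP, coeff_mk, ← R_eq]
  split_ifs with h
  · subst h
    have : R 3 0 = 0 := by
      simp [R, durfee]
    simp [this]
  · rfl
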